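/- Let d ≥ 3. There exist η₀ > 0 depending only on d and a universal constant C ≥ 1 such that: for every r ≥ 2 and every solution v of the hodograph PDE on the half-annulus A_r = {y : 1 ≤ |y| ≤ r, y_d ≥ 0} satisfying |∇v(y)| ≤ η₀ for all y ∈ A_r, one has max_{∂B_r⁺} v ≥ max_{∂B₁⁺} v − C·(max_{∂B₁⁺} v − max_{∂B₂⁺} v)₊ and min_{∂B_r⁺} v ≤ min_{∂B₁⁺} v + C·(min_{∂B₂⁺} v − min_{∂B₁⁺} v)₊, where (t)₊ = max(t,0). -/

import Mathlib

open Real Set Filter MeasureTheory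

noncomputable section

/-- The last index of `Fin d`. -/
def lastIdx (d : ℕ) (hd : 0 < d) : Fin d := ⟨d - 1, by omega⟩

/-- The `i`-th partial derivative of `v` at `y`. -/
def gradC (d : ℕ) (v : EuclideanSpace ℝ (Fin d) → ℝ)
    (y : EuclideanSpace ℝ (Fin d)) (i : Fin d) : ℝ :=
  fderiv ℝ v y (EuclideanSpace.single i 1)

/-- The `(i,j)` entry of the Hessian of `v` at `y`. -/
def hessC (d : ℕ) (v : EuclideanSpace ℝ (Fin d) → ℝ)
    (y : EuclideanSpace ℝ (Fin d)) (i j : Fin d) : ℝ :=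
  fderiv ℝ (fun z => fderiv ℝ v z (EuclideanSpace.single i 1)) y (EuclideanSpace.single j 1)

/-- The squared euclidean norm of the tangential part `p'` of `p`. -/
def tangSq (d : ℕ) (hd : 0 < d) (p : Fin d → ℝ) : ℝ :=
  ∑ m : Fin d, if m = lastIdx d hd then 0 else (p m) ^ 2

/-- The coefficient matrix `A(p)` of the hodograph PDE. -/
def hodA (d : ℕ) (hd : 0 < d) (p : Fin d → ℝ) (i j : Fin d) : ℝ :=
  if i = lastIdx d hd then
    (if j = lastIdx d hd then (1 + tangSq d hd p) / (1 + p (lastIdx d hd)) ^ 2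
     else p j / (1 + p (lastIdx d hd)))
  else
    (if j = lastIdx d hd then p i / (1 + p (lastIdx d hd))
     else if i = j then 1 else 0)

/-- The boundary nonlinearity `N(p') = √(1 + |p'|²) - 1`. -/
def hodN (d : ℕ) (hd : 0 < d) (p : Fin d → ℝ) : ℝ :=
  Real.sqrt (1 + tangSq d hd p) - 1

/-- The quantity `tr(A(∇v(y)) D²v(y))`. -/
def hodOp (d : ℕ) (hd : 0 < d) (v : EuclideanSpace ℝ (Fin d) → ℝ)
    (y : EuclideanSpace ℝ (Fin d)) : ℝ :=
  ∑ i : Fin d, ∑ j : Fin d, hodA d hd (fun m => gradC d v y m) i j * hessC d v y i j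

/-- `v` is `C^∞` on an open neighborhood of `U`. -/
def SmoothNear (d : ℕ) (v : EuclideanSpace ℝ (Fin d) → ℝ)
    (U : Set (EuclideanSpace ℝ (Fin d))) : Prop :=
  ∃ W : Set (EuclideanSpace ℝ (Fin d)), IsOpen W ∧ U ⊆ W ∧ ContDiffOn ℝ (⊤ : ℕ∞) v W

/-- `v` is a (classical) solution of the hodograph PDE on `U`. -/
def IsHodSol (d : ℕ) (hd : 0 < d) (v : EuclideanSpace ℝ (Fin d) → ℝ)
    (U : Set (EuclideanSpace ℝ (Fin d))) : Prop :=
  SmoothNear d v U ∧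
  (∀ y ∈ U, 0 < y (lastIdx d hd) → hodOp d hd v y = 0) ∧
  (∀ y ∈ U, y (lastIdx d hd) = 0 →
    gradC d v y (lastIdx d hd) = hodN d hd (fun m => gradC d v y m))

/-- `v` is a subsolution of the hodograph PDE on `U`. -/
def IsHodSubsol (d : ℕ) (hd : 0 < d) (v : EuclideanSpace ℝ (Fin d) → ℝ)
    (U : Set (EuclideanSpace ℝ (Fin d))) : Prop :=
  SmoothNear d v U ∧
  (∀ y ∈ U, 0 < y (lastIdx d hd) → 0 ≤ hodOp d hd v y) ∧
  (∀ y ∈ U, y (lastIdx d hd) = 0 →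
    hodN d hd (fun m => gradC d v y m) ≤ gradC d v y (lastIdx d hd))

/-- `v` is a supersolution of the hodograph PDE on `U`. -/
def IsHodSupersol (d : ℕ) (hd : 0 < d) (v : EuclideanSpace ℝ (Fin d) → ℝ)
    (U : Set (EuclideanSpace ℝ (Fin d))) : Prop :=
  SmoothNear d v U ∧
  (∀ y ∈ U, 0 < y (lastIdx d hd) → hodOp d hd v y ≤ 0) ∧
  (∀ y ∈ U, y (lastIdx d hd) = 0 →
    gradC d v y (lastIdx d hd) ≤ hodN d hd (fun m => gradC d v y m))

/-- The exterior half-space domain `H₁ = {y : y_d ≥ 0, |y| ≥ 1}`. -/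
def extDom (d : ℕ) (hd : 0 < d) : Set (EuclideanSpace ℝ (Fin d)) :=
  {y | 0 ≤ y (lastIdx d hd) ∧ 1 ≤ ‖y‖}

/-- The half annulus `A_r = {y : 1 ≤ |y| ≤ r, y_d ≥ 0}`. -/
def halfAnn (d : ℕ) (hd : 0 < d) (r : ℝ) : Set (EuclideanSpace ℝ (Fin d)) :=
  {y | 0 ≤ y (lastIdx d hd) ∧ 1 ≤ ‖y‖ ∧ ‖y‖ ≤ r}

/-- The upper half sphere `∂B_ρ⁺ = {y : y_d ≥ 0, |y| = ρ}`. -/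
def upSphere (d : ℕ) (hd : 0 < d) (ρ : ℝ) : Set (EuclideanSpace ℝ (Fin d)) :=
  {y | 0 ≤ y (lastIdx d hd) ∧ ‖y‖ = ρ}

/-- The filter of `|y| → ∞` within `H₁`. -/
def farFilter (d : ℕ) (hd : 0 < d) : Filter (EuclideanSpace ℝ (Fin d)) :=
  (Filter.comap (fun y : EuclideanSpace ℝ (Fin d) => ‖y‖) Filter.atTop) ⊓
    Filter.principal (extDom d hd)

/-- Necessary second-order condition for a local maximum of a function of one variable. -/
theorem IsLocalMax.second_hasDerivAt_nonpos {f f' : ℝ → ℝ} {a c : ℝ}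
    (h : IsLocalMax f a) (hf : ∀ᶠ t in nhds a, HasDerivAt f (f' t) t)
    (hf' : HasDerivAt f' c a) : c ≤ 0 := by
  by_contra! hc
  have hd : deriv f =ᶠ[nhds a] f' := hf.mono fun t ht => ht.deriv
  have h2 : deriv (deriv f) a = c := by rw [hd.deriv_eq, hf'.deriv]
  have hmin : IsLocalMin f a :=
    isLocalMin_of_deriv_deriv_pos (h2 ▸ hc) h.deriv_eq_zero hf.self_of_nhds.continuousAt
  have hconst : f =ᶠ[nhds a] fun _ => f a := by
    filter_upwards [h, hmin] with t h1 h2 using le_antisymm h1 h2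
  have h0 : deriv (deriv f) a = 0 := by
    rw [hconst.deriv.deriv_eq]
    simp
  linarith

/-- A function with a maximum over `[0, ∞)` near `0` has nonpositive derivative there. -/
theorem HasDerivAt.nonpos_of_eventually_le_right {f : ℝ → ℝ} {c : ℝ} (hf : HasDerivAt f c 0)
    (h : ∀ᶠ t in nhdsWithin 0 (Set.Ioi 0), f t ≤ f 0) : c ≤ 0 := by
  have ht := (hasDerivWithinAt_iff_tendsto_slope' (by simp)).1 (hf.hasDerivWithinAt (s := Set.Ioi 0))
  refine le_of_tendsto ht ?_
  filter_upwards [h, self_mem_nhdsWithin] with t h1 h2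
  rw [slope_def_field]
  exact div_nonpos_of_nonpos_of_nonneg (by linarith) (by simpa using (le_of_lt h2))

theorem sum_sq_apply_single (d : ℕ) (l : EuclideanSpace ℝ (Fin d) →L[ℝ] ℝ) :
    ∑ i, (l (EuclideanSpace.single i 1)) ^ 2 = ‖l‖ ^ 2 := by
  set g := (InnerProductSpace.toDual ℝ (EuclideanSpace ℝ (Fin d))).symm l with hg
  have h1 : ‖g‖ = ‖l‖ := by simp [hg]
  have h2 : ∀ x, l x = inner ℝ g x := fun x => by simp [hg]
  rw [← h1, EuclideanSpace.norm_sq_eq]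
  refine Finset.sum_congr rfl fun i _ => ?_
  rw [h2]
  simp [EuclideanSpace.inner_single_right]

theorem tangSq_eq_sum_erase (d : ℕ) (hd : 0 < d) (p : Fin d → ℝ) :
    tangSq d hd p = ∑ m ∈ Finset.univ.erase (lastIdx d hd), p m ^ 2 := by
  rw [tangSq, ← Finset.add_sum_erase _ _ (Finset.mem_univ (lastIdx d hd)), if_pos rfl, zero_add]
  exact Finset.sum_congr rfl fun m hm => if_neg (Finset.ne_of_mem_erase hm)

theorem tangSq_nonneg (d : ℕ) (hd : 0 < d) (p : Fin d → ℝ) : 0 ≤ tangSq d hd p := by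
  rw [tangSq_eq_sum_erase]
  positivity

theorem norm_sq_eq_last_add_tangSq (d : ℕ) (hd : 0 < d) (y : EuclideanSpace ℝ (Fin d)) :
    ‖y‖ ^ 2 = y (lastIdx d hd) ^ 2 + tangSq d hd y := by
  rw [tangSq_eq_sum_erase, EuclideanSpace.norm_sq_eq,
    ← Finset.add_sum_erase _ _ (Finset.mem_univ (lastIdx d hd))]
  simp

/-- Vectors `ξ k` with `∑ k, ξ k ⊗ ξ k = A(p)`. -/
def hodDir (d : ℕ) (hd : 0 < d) (p : Fin d → ℝ) (k : Fin d) : EuclideanSpace ℝ (Fin d) :=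
  if k = lastIdx d hd then EuclideanSpace.single k (1 / (1 + p k))
  else EuclideanSpace.single k 1 + EuclideanSpace.single (lastIdx d hd) (p k / (1 + p (lastIdx d hd)))

theorem sum_hodDir_mul (d : ℕ) (hd : 0 < d) (p : Fin d → ℝ) (i j : Fin d) :
    ∑ k, hodDir d hd p k i * hodDir d hd p k j = hodA d hd p i j := by
  set L := lastIdx d hd with hL
  rw [← Finset.add_sum_erase _ _ (Finset.mem_univ L)]
  have hk : ∀ k ∈ Finset.univ.erase L, hodDir d hd p k i * hodDir d hd p k j =
      ((if i = k then 1 else 0) + (if i = L then p k / (1 + p L) else 0)) *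
      ((if j = k then 1 else 0) + (if j = L then p k / (1 + p L) else 0)) := by
    intro k hk
    simp [hodDir, ← hL, Finset.ne_of_mem_erase hk, PiLp.single_apply]
  rw [Finset.sum_congr rfl hk]
  by_cases hi : i = L <;> by_cases hj : j = L
  · have : ∀ k ∈ Finset.univ.erase L, ((if i = k then 1 else 0) + (if i = L then p k / (1 + p L) else 0)) *
      ((if j = k then 1 else 0) + (if j = L then p k / (1 + p L) else 0)) =
        p k ^ 2 / (1 + p L) ^ 2 := by
      intro k hk
      have h := (Finset.ne_of_mem_erase hk).symm
      simp only [hi, hj, h, if_true, if_false]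
      rw [← div_pow]
      ring
    rw [Finset.sum_congr rfl this, ← Finset.sum_div, hodA, tangSq_eq_sum_erase]
    simp [hodDir, ← hL, hi, hj]
    simp only [div_eq_mul_inv, ← inv_pow]
    ring
  · have : ∀ k ∈ Finset.univ.erase L, ((if i = k then 1 else 0) + (if i = L then p k / (1 + p L) else 0)) *
      ((if j = k then 1 else 0) + (if j = L then p k / (1 + p L) else 0)) =
        if j = k then p k / (1 + p L) else 0 := by
      intro k hk
      have h := (Finset.ne_of_mem_erase hk).symm
      simp [h, hi, hj]
    rw [Finset.sum_congr rfl this, Finset.sum_ite_eq]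
    simp [hodDir, ← hL, hi, hj, hodA]
  · have : ∀ k ∈ Finset.univ.erase L, ((if i = k then 1 else 0) + (if i = L then p k / (1 + p L) else 0)) *
      ((if j = k then 1 else 0) + (if j = L then p k / (1 + p L) else 0)) =
        if i = k then p k / (1 + p L) else 0 := by
      intro k hk
      have h := (Finset.ne_of_mem_erase hk).symm
      simp [h, hi, hj]
    rw [Finset.sum_congr rfl this, Finset.sum_ite_eq]
    simp [hodDir, ← hL, hi, hj, hodA]
  · have : ∀ k ∈ Finset.univ.erase L, (((if i = k then 1 else 0) + (if i = L then p k / (1 + p L) else 0)) *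
      ((if j = k then 1 else 0) + (if j = L then p k / (1 + p L) else 0))) =
        if i = k then (if j = k then 1 else 0) else 0 := by
      intro k hk
      simp only [hi, hj, if_false, add_zero, ite_mul, one_mul, zero_mul]
    rw [Finset.sum_congr rfl this, Finset.sum_ite_eq]
    simp [hodDir, ← hL, hi, hj, hodA, eq_comm]

theorem hasDerivAt_comp_line {d : ℕ} {u : EuclideanSpace ℝ (Fin d) → ℝ}
    {y ξ : EuclideanSpace ℝ (Fin d)} {t : ℝ} (hu : DifferentiableAt ℝ u (y + t • ξ)) :
    HasDerivAt (fun t : ℝ => u (y + t • ξ)) (fderiv ℝ u (y + t • ξ) ξ) t := by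
  have h := ((hasDerivAt_id t).smul_const ξ).const_add y
  rw [one_smul] at h
  exact hu.hasFDerivAt.comp_hasDerivAt t h

theorem apply_eq_sum_single {d : ℕ} (l : EuclideanSpace ℝ (Fin d) →L[ℝ] ℝ)
    (ξ : EuclideanSpace ℝ (Fin d)) : l ξ = ∑ i, ξ i * l (EuclideanSpace.single i 1) := by
  have h : ξ = ∑ i, ξ i • EuclideanSpace.single i (1 : ℝ) := by
    ext j
    simp [Pi.single_apply]
  conv_lhs => rw [h]
  simp

theorem hasDerivAt_fderiv_comp_line {d : ℕ} {u : EuclideanSpace ℝ (Fin d) → ℝ}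
    {y : EuclideanSpace ℝ (Fin d)} (hu : ContDiffAt ℝ 2 u y) (ξ : EuclideanSpace ℝ (Fin d)) :
    HasDerivAt (fun t : ℝ => fderiv ℝ u (y + t • ξ) ξ)
      (∑ i, ∑ j, ξ i * ξ j * hessC d u y i j) 0 := by
  have hD : DifferentiableAt ℝ (fderiv ℝ u) y :=
    (hu.fderiv_right (m := 1) (by norm_num)).differentiableAt (by norm_num)
  have h1 : ∀ i, HasDerivAt
      (fun t : ℝ => ξ i * fderiv ℝ u (y + t • ξ) (EuclideanSpace.single i 1))
      (ξ i * ∑ j, ξ j * hessC d u y i j) 0 := by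
    intro i
    have hd : DifferentiableAt ℝ (fun z => fderiv ℝ u z (EuclideanSpace.single i 1))
        (y + (0 : ℝ) • ξ) := by
      rw [zero_smul, add_zero]
      exact hD.clm_apply (differentiableAt_const _)
    have h := hasDerivAt_comp_line hd
    rw [zero_smul, add_zero, apply_eq_sum_single] at h
    exact h.const_mul _
  have h2 := HasDerivAt.fun_sum fun i (_ : i ∈ Finset.univ) => h1 i
  have e : (fun t : ℝ => fderiv ℝ u (y + t • ξ) ξ) = fun t : ℝ =>
      ∑ i, ξ i * fderiv ℝ u (y + t • ξ) (EuclideanSpace.single i 1) :=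
    funext fun t => apply_eq_sum_single _ _
  rw [e]
  refine h2.congr_deriv ?_
  simp_rw [Finset.mul_sum, mul_assoc]

/-- The barrier `|y|^(-1/2) - y_d |y|^(-3/2) / 100`. -/
def hodBarrier (d : ℕ) (hd : 0 < d) (y : EuclideanSpace ℝ (Fin d)) : ℝ :=
  (‖y‖ ^ 2) ^ (-(1 / 4) : ℝ) -
    1 / 100 * y (lastIdx d hd) * ((‖y‖ ^ 2) ^ (-(1 / 4) : ℝ)) ^ 3

/-- The derivative of the barrier at `y` in direction `ξ`. -/
def hodBarrierDeriv (d : ℕ) (hd : 0 < d) (ξ y : EuclideanSpace ℝ (Fin d)) : ℝ :=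
  -(1 / 2) * inner ℝ y ξ * ((‖y‖ ^ 2) ^ (-(1 / 4) : ℝ)) ^ 5 -
    1 / 100 * (ξ (lastIdx d hd) * ((‖y‖ ^ 2) ^ (-(1 / 4) : ℝ)) ^ 3 -
      3 / 2 * y (lastIdx d hd) * inner ℝ y ξ * ((‖y‖ ^ 2) ^ (-(1 / 4) : ℝ)) ^ 7)

section Barrier

variable {d : ℕ} (hd : 0 < d) {y ξ : EuclideanSpace ℝ (Fin d)}

theorem rpow_neg_quarter_pow_four_mul {s : ℝ} (hs : 0 < s) :
    (s ^ (-(1 / 4) : ℝ)) ^ 4 * s = 1 := by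
  rw [← Real.rpow_natCast, ← Real.rpow_mul hs.le]
  norm_num
  rw [Real.rpow_neg_one, inv_mul_cancel₀ hs.ne']

theorem hasDerivAt_normSq_rpow_line {t : ℝ} (h : y + t • ξ ≠ 0) :
    HasDerivAt (fun t : ℝ => (‖y + t • ξ‖ ^ 2) ^ (-(1 / 4) : ℝ))
      (-(1 / 2) * inner ℝ (y + t • ξ) ξ * ((‖y + t • ξ‖ ^ 2) ^ (-(1 / 4) : ℝ)) ^ 5) t := by
  have h0 := ((hasDerivAt_id t).smul_const ξ).const_add y
  rw [one_smul] at h0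
  have h1 := h0.norm_sq
  have hs : 0 < ‖y + t • ξ‖ ^ 2 := by positivity
  have h2 := h1.rpow_const (p := (-(1 / 4) : ℝ)) (Or.inl hs.ne')
  refine h2.congr_deriv ?_
  have : (‖y + t • ξ‖ ^ 2) ^ (-(1 / 4) - 1 : ℝ) =
      ((‖y + t • ξ‖ ^ 2) ^ (-(1 / 4) : ℝ)) ^ 5 := by
    generalize ‖y + t • ξ‖ ^ 2 = s at hs
    rw [← Real.rpow_natCast, ← Real.rpow_mul hs.le]
    norm_num
  simp only [id]
  rw [this]
  ring

theorem hasDerivAt_coord_line (t : ℝ) (i : Fin d) :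
    HasDerivAt (fun t : ℝ => (y + t • ξ) i) (ξ i) t := by
  simpa using ((hasDerivAt_id t).mul_const (ξ i)).const_add (y i)

theorem hasDerivAt_inner_line (t : ℝ) :
    HasDerivAt (fun t : ℝ => (inner ℝ (y + t • ξ) ξ : ℝ)) (‖ξ‖ ^ 2) t := by
  simp_rw [inner_add_left, real_inner_smul_left, real_inner_self_eq_norm_sq]
  simpa using ((hasDerivAt_id t).mul_const (‖ξ‖ ^ 2)).const_add (inner ℝ y ξ)

theorem hasDerivAt_hodBarrier_line {t : ℝ} (h : y + t • ξ ≠ 0) :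
    HasDerivAt (fun t : ℝ => hodBarrier d hd (y + t • ξ))
      (hodBarrierDeriv d hd ξ (y + t • ξ)) t := by
  have hz := hasDerivAt_normSq_rpow_line h
  have hc := hasDerivAt_coord_line (y := y) (ξ := ξ) t (lastIdx d hd)
  refine (hz.sub ((hc.const_mul (1 / 100)).mul (hz.pow 3))).congr_deriv ?_
  simp only [hodBarrierDeriv, Pi.pow_apply]
  ring

theorem hasDerivAt_hodBarrierDeriv_line (h : y ≠ 0) {z : ℝ}
    (hz : z = (‖y‖ ^ 2) ^ (-(1 / 4) : ℝ)) :
    HasDerivAt (fun t : ℝ => hodBarrierDeriv d hd ξ (y + t • ξ))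
      (-(1 / 2) * z ^ 5 * ‖ξ‖ ^ 2 + 5 / 4 * z ^ 9 * inner ℝ y ξ ^ 2 +
        1 / 100 * (3 * z ^ 7 * (ξ (lastIdx d hd) * inner ℝ y ξ) +
          3 / 2 * z ^ 7 * y (lastIdx d hd) * ‖ξ‖ ^ 2 -
          21 / 4 * z ^ 11 * y (lastIdx d hd) * inner ℝ y ξ ^ 2)) 0 := by
  have h' : y + (0 : ℝ) • ξ ≠ 0 := by simpa using h
  have hZ := hasDerivAt_normSq_rpow_line h'
  have hc := hasDerivAt_coord_line (y := y) (ξ := ξ) 0 (lastIdx d hd)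
  have hi := hasDerivAt_inner_line (y := y) (ξ := ξ) 0
  refine (((hi.const_mul (-(1 / 2))).mul (hZ.pow 5)).sub
    ((((hZ.pow 3).const_mul (ξ (lastIdx d hd))).sub
      (((hc.const_mul (3 / 2)).mul hi).mul (hZ.pow 7))).const_mul (1 / 100))).congr_deriv ?_
  simp only [Pi.pow_apply, Pi.mul_apply, zero_smul, add_zero, ← hz]
  ring

theorem continuousOn_hodBarrier : ContinuousOn (hodBarrier d hd) {y | y ≠ 0} := by
  have h : ContinuousOn (fun y : EuclideanSpace ℝ (Fin d) => (‖y‖ ^ 2) ^ (-(1 / 4) : ℝ))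
      {y | y ≠ 0} :=
    ContinuousOn.rpow_const (by fun_prop) fun y hy => Or.inl (by simpa using hy)
  unfold hodBarrier
  exact h.sub (ContinuousOn.mul (by fun_prop) (h.pow 3))

theorem norm_sq_hodDir (p : Fin d → ℝ) (k : Fin d) : ‖hodDir d hd p k‖ ^ 2 =
    if k = lastIdx d hd then (1 / (1 + p k)) ^ 2
    else 1 + (p k / (1 + p (lastIdx d hd))) ^ 2 := by
  split_ifs with h
  · simp [hodDir, h]
  · rw [hodDir, if_neg h, norm_add_sq_real]
    simp [EuclideanSpace.inner_single_left, h, div_pow]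

theorem inner_hodDir (p : Fin d → ℝ) (k : Fin d) : inner ℝ y (hodDir d hd p k) =
    if k = lastIdx d hd then y k * (1 / (1 + p k))
    else y k + y (lastIdx d hd) * (p k / (1 + p (lastIdx d hd))) := by
  split_ifs with h
  · simp [hodDir, h, EuclideanSpace.inner_single_right, mul_comm]
  · simp [hodDir, h, inner_add_right, EuclideanSpace.inner_single_right, mul_comm]

theorem hodDir_last (p : Fin d → ℝ) (k : Fin d) : hodDir d hd p k (lastIdx d hd) =
    if k = lastIdx d hd then 1 / (1 + p k) else p k / (1 + p (lastIdx d hd)) := by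
  split_ifs with h
  · simp [hodDir, h]
  · simp [hodDir, h, Ne.symm h]

theorem barrier_estimate {a b X γ q T : ℝ} (ha0 : 0 ≤ a) (hX : 0 ≤ X) (hW : a ^ 2 + X = 1)
    (hγ0 : 0 ≤ γ) (hγ1 : γ ≤ 2 / 10000) (hq : q ≤ 103 / 100)
    (hT : 298 / 100 ≤ T) (hb : b ^ 2 ≤ X * γ) :
    -(1 / 2) * T + 5 / 4 * (q * a ^ 2 + (X + 2 * (a * b) + γ * a ^ 2)) +
      1 / 100 * (3 * (q * a + (b + γ * a)) + 3 / 2 * a * T) < 0 := by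
  have ha2 : a ^ 2 ≤ 1 := by linarith
  have ha1 : a ≤ 1 := by nlinarith
  have hb2 : b ^ 2 ≤ (2 / 100) ^ 2 := by
    have : X * γ ≤ 1 * (2 / 10000) := by
      gcongr
      nlinarith
    linarith
  have hb1 : b ≤ 2 / 100 := (abs_le_of_sq_le_sq' hb2 (by norm_num)).2
  have hab : a * b ≤ 1 * (2 / 100) := by nlinarith
  have h1 : q * a ^ 2 ≤ 103 / 100 * a ^ 2 := by gcongr
  have h2 : γ * a ^ 2 ≤ 2 / 10000 * 1 := by gcongr
  have h3 : q * a ≤ 103 / 100 * 1 := by gcongr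
  have h4 : γ * a ≤ 2 / 10000 * 1 := by gcongr
  have h5 : a * T ≤ 1 * T := by gcongr
  linarith

/-- The barrier is a strict supersolution of the linear equation with coefficients `A(p)`. -/
theorem sum_hodBarrier_second_neg (hd3 : 3 ≤ d) (hy : 0 ≤ y (lastIdx d hd)) (hy0 : y ≠ 0)
    {p : Fin d → ℝ} (hpL : |p (lastIdx d hd)| ≤ 1 / 100) (hpT : tangSq d hd p ≤ (1 / 100) ^ 2)
    {z : ℝ} (hz : z = (‖y‖ ^ 2) ^ (-(1 / 4) : ℝ)) :
    ∑ k, (-(1 / 2) * z ^ 5 * ‖hodDir d hd p k‖ ^ 2 +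
        5 / 4 * z ^ 9 * inner ℝ y (hodDir d hd p k) ^ 2 +
        1 / 100 * (3 * z ^ 7 * (hodDir d hd p k (lastIdx d hd) * inner ℝ y (hodDir d hd p k)) +
          3 / 2 * z ^ 7 * y (lastIdx d hd) * ‖hodDir d hd p k‖ ^ 2 -
          21 / 4 * z ^ 11 * y (lastIdx d hd) * inner ℝ y (hodDir d hd p k) ^ 2)) < 0 := by
  set L := lastIdx d hd with hL
  set q := 1 / (1 + p L) with hq
  set I := Finset.univ.erase L with hI
  set γ := ∑ k ∈ I, (p k / (1 + p L)) ^ 2 with hγ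
  set m := ∑ k ∈ I, y k * (p k / (1 + p L)) with hm
  set Y := tangSq d hd y with hY
  have hYs : Y = ∑ k ∈ I, y k ^ 2 := tangSq_eq_sum_erase d hd y
  have hs : ‖y‖ ^ 2 = y L ^ 2 + Y := norm_sq_eq_last_add_tangSq d hd y
  have hT : ∑ k, ‖hodDir d hd p k‖ ^ 2 = q ^ 2 + ((d : ℝ) - 1) + γ := by
    rw [← Finset.add_sum_erase _ _ (Finset.mem_univ L),
      Finset.sum_congr rfl (g := fun k => 1 + (p k / (1 + p L)) ^ 2)
        (fun k hk => by rw [norm_sq_hodDir, if_neg (Finset.ne_of_mem_erase hk)]),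
      norm_sq_hodDir, if_pos rfl, Finset.sum_add_distrib]
    simp only [Finset.sum_const, nsmul_eq_mul, mul_one, Finset.card_erase_of_mem (Finset.mem_univ L),
      Finset.card_univ, Fintype.card_fin]
    rw [Nat.cast_sub (by omega)]
    push_cast
    ring
  have hQ : ∑ k, inner ℝ y (hodDir d hd p k) ^ 2 =
      q ^ 2 * y L ^ 2 + (Y + 2 * y L * m + γ * y L ^ 2) := by
    rw [← Finset.add_sum_erase _ _ (Finset.mem_univ L),
      Finset.sum_congr rfl (g := fun k => (y k ^ 2 + 2 * y L * (y k * (p k / (1 + p L)))) +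
          (p k / (1 + p L)) ^ 2 * y L ^ 2)
        (fun k hk => by rw [inner_hodDir, if_neg (Finset.ne_of_mem_erase hk)]; ring),
      inner_hodDir, if_pos rfl, Finset.sum_add_distrib, Finset.sum_add_distrib,
      ← Finset.mul_sum, ← Finset.sum_mul, ← hYs]
    ring
  have hR : ∑ k, hodDir d hd p k L * inner ℝ y (hodDir d hd p k) =
      q ^ 2 * y L + (m + γ * y L) := by
    rw [← Finset.add_sum_erase _ _ (Finset.mem_univ L),
      Finset.sum_congr rfl (g := fun k => y k * (p k / (1 + p L)) + (p k / (1 + p L)) ^ 2 * y L)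
        (fun k hk => by
          rw [inner_hodDir, hodDir_last, if_neg (Finset.ne_of_mem_erase hk),
            if_neg (Finset.ne_of_mem_erase hk)]; ring),
      inner_hodDir, hodDir_last, if_pos rfl, if_pos rfl, Finset.sum_add_distrib, ← Finset.sum_mul]
    ring
  have hCS : m ^ 2 ≤ Y * γ := by
    rw [hYs]
    exact Finset.sum_mul_sq_le_sq_mul_sq _ _ _
  have hp := abs_le.1 hpL
  have hp1 : 0 < 1 + p L := by linarith
  have hq1 : 99 / 100 ≤ q := by
    rw [hq, le_div_iff₀ hp1]; linarith
  have hq2 : q ≤ 100 / 99 := by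
    rw [hq, div_le_iff₀ hp1]; linarith
  have hγe : γ = q ^ 2 * tangSq d hd p := by
    rw [tangSq_eq_sum_erase, hγ, Finset.mul_sum]
    exact Finset.sum_congr rfl fun k _ => by rw [hq]; ring
  have hγ0 : 0 ≤ γ := by positivity
  have hqq1 : 98 / 100 ≤ q ^ 2 := by nlinarith
  have hqq2 : q ^ 2 ≤ 103 / 100 := by nlinarith
  have hγ1 : γ ≤ 2 / 10000 := by
    rw [hγe]
    have := tangSq_nonneg d hd p
    nlinarith
  have hs0 : 0 < ‖y‖ ^ 2 := by positivity
  have hz0 : 0 < z := hz ▸ Real.rpow_pos_of_pos hs0 _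
  have hzs : z ^ 4 * ‖y‖ ^ 2 = 1 := hz ▸ rpow_neg_quarter_pow_four_mul hs0
  have hY0 : 0 ≤ Y := tangSq_nonneg _ _ _
  set T := ∑ k, ‖hodDir d hd p k‖ ^ 2
  set Q := ∑ k, inner ℝ y (hodDir d hd p k) ^ 2
  set R := ∑ k, hodDir d hd p k L * inner ℝ y (hodDir d hd p k)
  have hQ0 : 0 ≤ Q := Finset.sum_nonneg fun k _ => sq_nonneg _
  have hsum : ∑ k, (-(1 / 2) * z ^ 5 * ‖hodDir d hd p k‖ ^ 2 +
        5 / 4 * z ^ 9 * inner ℝ y (hodDir d hd p k) ^ 2 +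
        1 / 100 * (3 * z ^ 7 * (hodDir d hd p k L * inner ℝ y (hodDir d hd p k)) +
          3 / 2 * z ^ 7 * y L * ‖hodDir d hd p k‖ ^ 2 -
          21 / 4 * z ^ 11 * y L * inner ℝ y (hodDir d hd p k) ^ 2)) =
      z ^ 5 * (-(1 / 2) * T + 5 / 4 * (z ^ 4 * Q) +
        1 / 100 * (3 * (z ^ 2 * R) + 3 / 2 * (z ^ 2 * y L) * T -
          21 / 4 * (z ^ 6 * y L * Q))) := by
    simp only [Finset.sum_add_distrib, Finset.sum_sub_distrib, ← Finset.mul_sum]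
    ring
  rw [hsum]
  have hd3' : (3 : ℝ) ≤ d := by exact_mod_cast hd3
  have hlast : 0 ≤ z ^ 6 * y L * Q := by positivity
  refine mul_neg_of_pos_of_neg (by positivity) ?_
  have hk := barrier_estimate (a := z ^ 2 * y L) (b := z ^ 2 * m) (X := z ^ 4 * Y) (γ := γ)
    (q := q ^ 2) (T := T) (by positivity) (by positivity) (by rw [← hzs, hs]; ring)
    hγ0 hγ1 hqq2 (by rw [hT]; linarith)
    (calc (z ^ 2 * m) ^ 2 = z ^ 4 * m ^ 2 := by ring
        _ ≤ z ^ 4 * (Y * γ) := by gcongr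
        _ = _ := by ring)
  have e1 : z ^ 4 * Q = q ^ 2 * (z ^ 2 * y L) ^ 2 + (z ^ 4 * Y + 2 * ((z ^ 2 * y L) * (z ^ 2 * m)) +
      γ * (z ^ 2 * y L) ^ 2) := by rw [hQ]; ring
  have e2 : z ^ 2 * R = q ^ 2 * (z ^ 2 * y L) + (z ^ 2 * m + γ * (z ^ 2 * y L)) := by rw [hR]; ring
  rw [← e1, ← e2] at hk
  linarith

end Barrier

/-- A function satisfying a linearised hodograph equation stays below the barrier. -/
theorem le_on_upSphere_two {d : ℕ} (hd : 0 < d) (hd3 : 3 ≤ d) {r : ℝ} (hr : 2 ≤ r)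
    {u : EuclideanSpace ℝ (Fin d) → ℝ} (hsm : SmoothNear d u (halfAnn d hd r))
    (hint : ∀ y ∈ halfAnn d hd r, 0 < y (lastIdx d hd) → ∃ p : Fin d → ℝ,
      |p (lastIdx d hd)| ≤ 1 / 100 ∧ tangSq d hd p ≤ (1 / 100) ^ 2 ∧
      ∑ i, ∑ j, hodA d hd p i j * hessC d u y i j = 0)
    (hbd : ∀ y ∈ halfAnn d hd r, y (lastIdx d hd) = 0 →
      -(1 / 200) * √(tangSq d hd (gradC d u y)) ≤ gradC d u y (lastIdx d hd))
    {M m : ℝ} (hmM : m < M) (hM : ∀ y ∈ upSphere d hd 1, u y ≤ M)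
    (hm : ∀ y ∈ upSphere d hd r, u y ≤ m) :
    ∀ y ∈ upSphere d hd 2, u y ≤ M - 1 / 4 * (M - m) := by
  obtain ⟨W, hWo, hW, hu⟩ := hsm
  set L := lastIdx d hd with hL
  have hcd : ∀ y ∈ W, ContDiffAt ℝ 2 u y := fun y hy =>
    (hu.contDiffAt (hWo.mem_nhds hy)).of_le (by
      rw [show (2 : WithTop ℕ∞) = ((2 : ℕ∞) : WithTop ℕ∞) from rfl]
      exact WithTop.coe_le_coe.2 le_top)
  set δ := M - m with hδ
  have hδ0 : 0 < δ := by linarith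
  have hne : ∀ y ∈ halfAnn d hd r, y ≠ 0 := by
    rintro y hy rfl
    have := hy.2.1
    simp at this
    linarith
  have hcoord : ∀ y : EuclideanSpace ℝ (Fin d), y L ≤ ‖y‖ := fun y =>
    (le_abs_self _).trans (PiLp.norm_apply_le y L)
  set w : EuclideanSpace ℝ (Fin d) → ℝ := fun y => u y - δ * hodBarrier d hd y with hw
  have hclosed : IsClosed (halfAnn d hd r) := by
    have h1 : Continuous fun y : EuclideanSpace ℝ (Fin d) => y L := by fun_prop
    exact (isClosed_le continuous_const h1).inter
      ((isClosed_le continuous_const continuous_norm).inter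
        (isClosed_le continuous_norm continuous_const))
  have hcomp : IsCompact (halfAnn d hd r) :=
    Metric.isCompact_of_isClosed_isBounded hclosed
      (Metric.isBounded_closedBall (x := 0) (r := r) |>.subset fun y hy => by
        simpa using hy.2.2)
  have hwc : ContinuousOn w (halfAnn d hd r) :=
    (hu.continuousOn.mono hW).sub
      (continuousOn_const.mul ((continuousOn_hodBarrier hd).mono hne))
  have hzs : ∀ y : EuclideanSpace ℝ (Fin d), y ≠ 0 →
      0 < (‖y‖ ^ 2) ^ (-(1 / 4) : ℝ) ∧ ((‖y‖ ^ 2) ^ (-(1 / 4) : ℝ)) ^ 4 * ‖y‖ ^ 2 = 1 := by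
    intro y hy
    have : 0 < ‖y‖ ^ 2 := by positivity
    exact ⟨Real.rpow_pos_of_pos this _, rpow_neg_quarter_pow_four_mul this⟩
  have hmain : ∀ y ∈ halfAnn d hd r, w y ≤ M - δ * (99 / 100) := by
    intro x hx
    obtain ⟨y, hy, hmax⟩ := hcomp.exists_isMaxOn ⟨x, hx⟩ hwc
    refine (hmax hx).trans ?_
    by_contra! hgt
    have hy0 := hne y hy
    obtain ⟨hz0, hz4⟩ := hzs y hy0
    set z := (‖y‖ ^ 2) ^ (-(1 / 4) : ℝ) with hz
    have hBy : hodBarrier d hd y = z - 1 / 100 * y L * z ^ 3 := rfl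
    have h1 : 1 < ‖y‖ := by
      refine lt_of_le_of_ne hy.2.1 fun h => ?_
      have hz1 : z = 1 := by rw [hz, ← h]; norm_num
      have := hM y ⟨hy.1, h.symm⟩
      have h2 := hcoord y
      simp only [hw, hBy, hz1] at hgt
      nlinarith
    have h2 : ‖y‖ < r := by
      refine lt_of_le_of_ne hy.2.2 fun h => ?_
      have := hm y ⟨hy.1, h⟩
      have hc := hcoord y
      have hyL := hy.1
      have hB : 0 ≤ hodBarrier d hd y + 1 / 100 := by
        rw [hBy]
        have e1 : (z ^ 2 * ‖y‖) ^ 2 = 1 := by rw [← hz4]; ring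
        have e2 : z ^ 2 * ‖y‖ = 1 := by
          have : 0 ≤ z ^ 2 * ‖y‖ := by positivity
          nlinarith
        have e3 : z ^ 2 * y L ≤ 1 := by
          rw [← e2]; gcongr
        nlinarith
      simp only [hw] at hgt
      nlinarith
    have hdiff : ∀ ξ : EuclideanSpace ℝ (Fin d), ∀ᶠ t in nhds (0 : ℝ),
        HasDerivAt (fun t : ℝ => w (y + t • ξ))
          (fderiv ℝ u (y + t • ξ) ξ - δ * hodBarrierDeriv d hd ξ (y + t • ξ)) t := by
      intro ξ
      have hc : ContinuousAt (fun t : ℝ => y + t • ξ) 0 := by fun_prop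
      have e1 : ∀ᶠ t in nhds (0 : ℝ), y + t • ξ ∈ W :=
        hc.eventually_mem (hWo.mem_nhds (by simpa using hW hy))
      have e2 : ∀ᶠ t in nhds (0 : ℝ), y + t • ξ ≠ 0 := hc.eventually_ne (by simpa using hy0)
      filter_upwards [e1, e2] with t ht1 ht2
      exact (hasDerivAt_comp_line ((hcd _ ht1).differentiableAt (by norm_num))).sub
        ((hasDerivAt_hodBarrier_line hd ht2).const_mul δ)
    have hdiff0 : ∀ ξ : EuclideanSpace ℝ (Fin d), HasDerivAt (fun t : ℝ => w (y + t • ξ))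
          (fderiv ℝ u y ξ - δ * hodBarrierDeriv d hd ξ y) 0 := by
      intro ξ
      simpa using (hdiff ξ).self_of_nhds
    have hnorm : ∀ ξ : EuclideanSpace ℝ (Fin d), ∀ᶠ t in nhds (0 : ℝ),
        1 < ‖y + t • ξ‖ ∧ ‖y + t • ξ‖ < r := by
      intro ξ
      have hc : ContinuousAt (fun t : ℝ => ‖y + t • ξ‖) 0 := by fun_prop
      exact (hc.eventually_const_lt (by simpa using h1)).and
        (hc.eventually_lt_const (by simpa using h2))
    rcases hy.1.lt_or_eq with hyL | hyL
    · obtain ⟨p, hpL, hpT, hp0⟩ := hint y hy hyL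
      have hloc : ∀ ξ : EuclideanSpace ℝ (Fin d), IsLocalMax (fun t : ℝ => w (y + t • ξ)) 0 := by
        intro ξ
        have hc : ContinuousAt (fun t : ℝ => (y + t • ξ) L) 0 := by
          exact (hasDerivAt_coord_line 0 L).continuousAt
        filter_upwards [hnorm ξ, hc.eventually_const_lt (u := 0) (by simpa using hyL)] with t h1 h2
        have := hmax (show y + t • ξ ∈ halfAnn d hd r from ⟨h2.le, h1.1.le, h1.2.le⟩)
        simpa using this
      have hsec := fun ξ => (hloc ξ).second_hasDerivAt_nonpos (hdiff ξ)
        ((hasDerivAt_fderiv_comp_line (hcd y (hW hy)) ξ).sub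
          ((hasDerivAt_hodBarrierDeriv_line hd hy0 hz).const_mul δ))
      have hs := Finset.sum_nonpos fun k (_ : k ∈ Finset.univ) => hsec (hodDir d hd p k)
      rw [Finset.sum_sub_distrib, ← Finset.mul_sum] at hs
      have hneg := sum_hodBarrier_second_neg hd hd3 hy.1 hy0 hpL hpT hz
      have hzero : ∑ k, ∑ i, ∑ j, hodDir d hd p k i * hodDir d hd p k j * hessC d u y i j = 0 := by
        rw [← hp0, Finset.sum_comm]
        refine Finset.sum_congr rfl fun i _ => ?_
        rw [Finset.sum_comm]
        refine Finset.sum_congr rfl fun j _ => ?_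
        rw [← Finset.sum_mul, sum_hodDir_mul]
      rw [hzero] at hs
      nlinarith
    · have hyL' : y L = 0 := hyL.symm
      have htan : ∀ i, i ≠ L → gradC d u y i = δ * (-(1 / 2) * z ^ 5) * y i := by
        intro i hi
        have hloc : IsLocalMax (fun t : ℝ => w (y + t • EuclideanSpace.single i 1)) 0 := by
          filter_upwards [hnorm (EuclideanSpace.single i 1)] with t h1
          have := hmax (show y + t • EuclideanSpace.single i 1 ∈ halfAnn d hd r from
            ⟨by simp [← hL, hyL', Ne.symm hi], h1.1.le, h1.2.le⟩)
          simpa using this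
        have h := hloc.hasDerivAt_eq_zero (hdiff0 _)
        have h' : hodBarrierDeriv d hd (EuclideanSpace.single i 1) y = -(1 / 2) * y i * z ^ 5 := by
          simp [hodBarrierDeriv, ← hL, hyL', Ne.symm hi, EuclideanSpace.inner_single_right, hz]
        rw [h'] at h
        simp only [gradC]
        linarith
      have hnormal : gradC d u y L ≤ -(δ * (1 / 100) * z ^ 3) := by
        have h := (hdiff0 (EuclideanSpace.single L 1)).nonpos_of_eventually_le_right (by
          filter_upwards [nhdsWithin_le_nhds (hnorm (EuclideanSpace.single L 1)),
            self_mem_nhdsWithin] with t h1 ht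
          have := hmax (show y + t • EuclideanSpace.single L 1 ∈ halfAnn d hd r from
            ⟨by simpa [← hL, hyL'] using le_of_lt ht, h1.1.le, h1.2.le⟩)
          simpa using this)
        have h' : hodBarrierDeriv d hd (EuclideanSpace.single L 1) y = -(1 / 100) * z ^ 3 := by
          simp [hodBarrierDeriv, ← hL, hyL', EuclideanSpace.inner_single_right, hz]
        rw [h'] at h
        simp only [gradC]
        linarith
      have htsq : tangSq d hd (gradC d u y) = (δ * (1 / 2) * z ^ 3) ^ 2 := by
        have e : tangSq d hd y = ‖y‖ ^ 2 := by
          rw [norm_sq_eq_last_add_tangSq d hd, ← hL, hyL']; ring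
        have : tangSq d hd (gradC d u y) = (δ * (-(1 / 2) * z ^ 5)) ^ 2 * tangSq d hd y := by
          rw [tangSq_eq_sum_erase, tangSq_eq_sum_erase, Finset.mul_sum]
          refine Finset.sum_congr rfl fun i hi => ?_
          rw [htan i (Finset.ne_of_mem_erase hi)]
          ring
        rw [this, e]
        linear_combination δ ^ 2 / 4 * z ^ 6 * hz4
      have hb := hbd y hy hyL'
      rw [htsq, Real.sqrt_sq (by positivity)] at hb
      have : 0 < δ * z ^ 3 := by positivity
      linarith
  intro y hy
  have hyA : y ∈ halfAnn d hd r := ⟨hy.1, by rw [hy.2]; norm_num, by rw [hy.2]; exact hr⟩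
  have h := hmain y hyA
  obtain ⟨hz0, hz4⟩ := hzs y (hne y hyA)
  simp only [hw, hodBarrier, ← hL] at h
  set z := (‖y‖ ^ 2) ^ (-(1 / 4) : ℝ) with hz
  rw [hy.2] at hz4
  have hz1 : z ≤ 72 / 100 := by
    by_contra! hlt
    have : (72 / 100 : ℝ) ^ 4 < z ^ 4 := by gcongr
    norm_num at this
    linarith
  have hpos : 0 ≤ 1 / 100 * y L * z ^ 3 := by
    have := hy.1
    positivity
  nlinarith

theorem isCompact_upSphere (d : ℕ) (hd : 0 < d) (ρ : ℝ) : IsCompact (upSphere d hd ρ) := by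
  have h1 : Continuous fun y : EuclideanSpace ℝ (Fin d) => y (lastIdx d hd) := by fun_prop
  refine Metric.isCompact_of_isClosed_isBounded
    ((isClosed_le continuous_const h1).inter (isClosed_eq continuous_norm continuous_const))
    (Metric.isBounded_closedBall (x := 0) (r := ρ) |>.subset fun y hy => by
        simpa using hy.2.le)

theorem upSphere_nonempty (d : ℕ) (hd : 0 < d) {ρ : ℝ} (hρ : 0 ≤ ρ) :
    (upSphere d hd ρ).Nonempty :=
  ⟨EuclideanSpace.single (lastIdx d hd) ρ, by simpa using hρ, by simpa using hρ⟩

/-- The one-sided growth bound for solutions of a linearised hodograph equation. -/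
theorem sSup_upSphere_growth {d : ℕ} (hd : 0 < d) (hd3 : 3 ≤ d) {r : ℝ} (hr : 2 ≤ r)
    {u : EuclideanSpace ℝ (Fin d) → ℝ} (hsm : SmoothNear d u (halfAnn d hd r))
    (hint : ∀ y ∈ halfAnn d hd r, 0 < y (lastIdx d hd) → ∃ p : Fin d → ℝ,
      |p (lastIdx d hd)| ≤ 1 / 100 ∧ tangSq d hd p ≤ (1 / 100) ^ 2 ∧
      ∑ i, ∑ j, hodA d hd p i j * hessC d u y i j = 0)
    (hbd : ∀ y ∈ halfAnn d hd r, y (lastIdx d hd) = 0 →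
      -(1 / 200) * √(tangSq d hd (gradC d u y)) ≤ gradC d u y (lastIdx d hd)) :
    sSup (u '' upSphere d hd 1) -
        4 * max (sSup (u '' upSphere d hd 1) - sSup (u '' upSphere d hd 2)) 0
      ≤ sSup (u '' upSphere d hd r) := by
  have hcont : ContinuousOn u (halfAnn d hd r) := by
    obtain ⟨W, _, hW, hu⟩ := hsm
    exact hu.continuousOn.mono hW
  have hbdd : ∀ ρ, 1 ≤ ρ → ρ ≤ r → ∀ y ∈ upSphere d hd ρ, u y ≤ sSup (u '' upSphere d hd ρ) := by
    intro ρ h1 h2 y hy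
    refine le_csSup ?_ (Set.mem_image_of_mem u hy)
    exact ((isCompact_upSphere d hd ρ).image_of_continuousOn (hcont.mono fun x hx =>
      ⟨hx.1, by rw [hx.2]; exact h1, by rw [hx.2]; exact h2⟩)).bddAbove
  rcases le_or_gt (sSup (u '' upSphere d hd 1)) (sSup (u '' upSphere d hd r)) with h | h
  · have := le_max_right (sSup (u '' upSphere d hd 1) - sSup (u '' upSphere d hd 2)) 0
    linarith
  · have h2 := le_on_upSphere_two hd hd3 hr hsm hint hbd h
      (hbdd 1 le_rfl (by linarith)) (hbdd r (by linarith) le_rfl)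
    have h3 := csSup_le ((upSphere_nonempty d hd (by norm_num : (0 : ℝ) ≤ 2)).image u)
      (Set.forall_mem_image.2 h2)
    have := le_max_left (sSup (u '' upSphere d hd 1) - sSup (u '' upSphere d hd 2)) 0
    linarith

theorem sSup_neg_image {α : Type*} (v : α → ℝ) (S : Set α) :
    sSup ((fun y => -v y) '' S) = -sInf (v '' S) := by
  rw [Real.sInf_def, neg_neg, ← Set.image_neg_eq_neg, Set.image_image]

theorem gradC_neg (d : ℕ) (v : EuclideanSpace ℝ (Fin d) → ℝ) (y : EuclideanSpace ℝ (Fin d))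
    (i : Fin d) : gradC d (fun z => -v z) y i = -gradC d v y i := by
  simp [gradC, fderiv_fun_neg]

theorem hessC_neg (d : ℕ) (v : EuclideanSpace ℝ (Fin d) → ℝ) (y : EuclideanSpace ℝ (Fin d))
    (i j : Fin d) : hessC d (fun z => -v z) y i j = -hessC d v y i j := by
  simp [hessC, fderiv_fun_neg]

/-- Growth bound for solutions on the half annulus, `d ≥ 3`. -/
theorem stmt2 (d : ℕ) (hd : 3 ≤ d) :
    ∃ η₀ : ℝ, 0 < η₀ ∧ ∃ C : ℝ, 1 ≤ C ∧
      ∀ r : ℝ, 2 ≤ r → ∀ v : EuclideanSpace ℝ (Fin d) → ℝ,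
        IsHodSol d (by omega) v (halfAnn d (by omega) r) →
        (∀ y ∈ halfAnn d (by omega) r, ‖fderiv ℝ v y‖ ≤ η₀) →
        sSup (v '' upSphere d (by omega) 1) -
            C * max (sSup (v '' upSphere d (by omega) 1) - sSup (v '' upSphere d (by omega) 2)) 0
          ≤ sSup (v '' upSphere d (by omega) r) ∧
        sInf (v '' upSphere d (by omega) r)
          ≤ sInf (v '' upSphere d (by omega) 1) +
            C * max (sInf (v '' upSphere d (by omega) 2) - sInf (v '' upSphere d (by omega) 1)) 0 := by
  have hd0 : 0 < d := by omega
  refine ⟨1 / 100, by norm_num, 4, by norm_num, fun r hr v hv hg => ?_⟩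
  obtain ⟨hsm, hint, hbd⟩ := hv
  have hgr : ∀ y ∈ halfAnn d hd0 r, |gradC d v y (lastIdx d hd0)| ≤ 1 / 100 ∧
      tangSq d hd0 (gradC d v y) ≤ (1 / 100) ^ 2 := by
    intro y hy
    have h1 := sum_sq_apply_single d (fderiv ℝ v y)
    have h2 : ‖fderiv ℝ v y‖ ^ 2 ≤ (1 / 100) ^ 2 := by
      have := hg y hy
      gcongr
    rw [← h1, ← Finset.add_sum_erase _ _ (Finset.mem_univ (lastIdx d hd0))] at h2
    have h3 := tangSq_eq_sum_erase d hd0 (gradC d v y)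
    have h4 := tangSq_nonneg d hd0 (gradC d v y)
    simp only [gradC] at h3 h4 ⊢
    refine ⟨abs_le_of_sq_le_sq (by linarith) (by norm_num), ?_⟩
    have := sq_nonneg (fderiv ℝ v y (EuclideanSpace.single (lastIdx d hd0) 1))
    linarith
  refine ⟨sSup_upSphere_growth hd0 hd hr hsm ?_ ?_, ?_⟩
  · exact fun y hy hyL => ⟨_, (hgr y hy).1, (hgr y hy).2, hint y hy hyL⟩
  · intro y hy hyL
    rw [hbd y hy hyL, hodN]
    have h1 := tangSq_nonneg d hd0 (gradC d v y)
    have h2 : 1 ≤ √(1 + tangSq d hd0 (gradC d v y)) := Real.one_le_sqrt.2 (by linarith)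
    have h3 := Real.sqrt_nonneg (tangSq d hd0 (gradC d v y))
    linarith
  · have h := sSup_upSphere_growth hd0 hd hr (u := fun y => -v y) ?_ ?_ ?_
    · simp only [sSup_neg_image] at h
      have e : -sInf (v '' upSphere d hd0 1) - -sInf (v '' upSphere d hd0 2) =
          sInf (v '' upSphere d hd0 2) - sInf (v '' upSphere d hd0 1) := by ring
      rw [e] at h
      linarith
    · obtain ⟨W, hWo, hW, hv⟩ := hsm
      exact ⟨W, hWo, hW, hv.neg⟩
    · refine fun y hy hyL => ⟨_, (hgr y hy).1, (hgr y hy).2, ?_⟩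
      have h := hint y hy hyL
      simp only [hodOp] at h
      simp only [hessC_neg, mul_neg, Finset.sum_neg_distrib]
      rw [neg_eq_zero]
      exact h
    · intro y hy hyL
      have e : tangSq d hd0 (gradC d (fun z => -v z) y) = tangSq d hd0 (gradC d v y) := by
        simp [tangSq, gradC_neg]
      rw [e, gradC_neg, hbd y hy hyL, hodN]
      have h1 := tangSq_nonneg d hd0 (gradC d v y)
      set σ := √(tangSq d hd0 (gradC d v y)) with hσ
      have hσ0 : 0 ≤ σ := Real.sqrt_nonneg _
      have hσ2 : σ ^ 2 = tangSq d hd0 (gradC d v y) := Real.sq_sqrt h1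
      have hσ1 : σ ≤ 1 / 100 := by
        have := (hgr y hy).2
        nlinarith
      have h2 : √(1 + tangSq d hd0 (gradC d v y)) ≤ 1 + 1 / 200 * σ := by
        rw [← hσ2]
        refine Real.sqrt_le_iff.2 ⟨by positivity, ?_⟩
        nlinarith
      linarith
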